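/- There exists a constant C > 0 such that the following holds. For all n, d, for every injective tuple v_1, …, v_n ∈ 𝔽₂^d with V = {v_1, …, v_n}, for all finite sets N_1, …, N_n ⊆ V satisfying condition (i) (for all i, v_i + N_i = N_i) and condition (ii) (for all i and all j < i, v_j ∉ span_{𝔽₂}(N_i + N_i)), and for every 𝔽₂-linear subspace H ≤ 𝔽₂^d, one has Σ_{i : v_i ∉ H} |N_i ∩ (H ∪ (v_i + H))| ≤ C · n · |H|^{(log₂ 3)/2}. -/

import Mathlib

open Pointwise
open scoped Classical

/-- The functions `E → ZMod 2` that are, in the coordinates of `b`, multilinear polynomials of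
degree at most `t`. -/
def lowDegree {ι E : Type*} [AddCommGroup E] [Module (ZMod 2) E] (b : Module.Basis ι (ZMod 2) E)
    (t : ℕ) : Submodule (ZMod 2) (E → ZMod 2) :=
  Submodule.span (ZMod 2)
    ((fun (S : Finset ι) (y : E) => ∏ i ∈ S, b.coord i y) '' {S | S.card ≤ t})

section LowDegree

variable {ι E : Type*} [AddCommGroup E] [Module (ZMod 2) E] (b : Module.Basis ι (ZMod 2) E)

theorem lowDegree_mono {s t : ℕ} (h : s ≤ t) : lowDegree b s ≤ lowDegree b t :=
  Submodule.span_mono (Set.image_mono fun _ hS => le_trans hS h)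

theorem one_mem_lowDegree (t : ℕ) : (1 : E → ZMod 2) ∈ lowDegree b t :=
  Submodule.subset_span ⟨∅, by simp, by ext; simp⟩

theorem coord_mul_mem_lowDegree (i : ι) {t : ℕ} {f : E → ZMod 2} (hf : f ∈ lowDegree b t) :
    (fun y => b.coord i y) * f ∈ lowDegree b (t + 1) := by
  induction hf using Submodule.span_induction with
  | mem f hf =>
    obtain ⟨S, hS, rfl⟩ := hf
    have hS : S.card ≤ t := hS
    refine Submodule.subset_span ⟨insert i S, (Finset.card_insert_le i S).trans (by omega), ?_⟩
    ext y
    by_cases hi : i ∈ S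
    · have hsq : ∀ a : ZMod 2, a * a = a := by decide
      simp only [Finset.insert_eq_of_mem hi, Pi.mul_apply]
      rw [← Finset.mul_prod_erase S _ hi, ← mul_assoc, hsq]
    · simp [Finset.prod_insert hi]
  | zero => simp
  | add f g _ _ hf hg => rw [mul_add]; exact add_mem hf hg
  | smul c f _ hf => rw [mul_smul_comm]; exact Submodule.smul_mem _ c hf

theorem affine_mul_mem_lowDegree [Finite ι] (l : E →ₗ[ZMod 2] ZMod 2) (c : ZMod 2) {t : ℕ}
    {f : E → ZMod 2} (hf : f ∈ lowDegree b t) :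
    (fun y => c + l y) * f ∈ lowDegree b (t + 1) := by
  have := Fintype.ofFinite ι
  have key : (fun y => c + l y) * f =
      c • f + ∑ i, l (b i) • ((fun y => b.coord i y) * f) := by
    ext y
    have hl : l y = ∑ i, l (b i) * b.coord i y := by
      conv_lhs => rw [← b.sum_repr y]
      simp only [map_sum, map_smul, smul_eq_mul, Module.Basis.coord_apply, mul_comm]
    simp [hl, add_mul, Finset.sum_mul, mul_assoc]
  rw [key]
  exact add_mem (Submodule.smul_mem _ _ (lowDegree_mono b t.le_succ hf))
    (Submodule.sum_mem _ fun i _ => Submodule.smul_mem _ _ (coord_mul_mem_lowDegree b i hf))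

theorem prod_affine_mem_lowDegree [Finite ι] {κ : Type*} (s : Finset κ)
    (l : κ → E →ₗ[ZMod 2] ZMod 2) (c : κ → ZMod 2) :
    ∏ j ∈ s, (fun y => c j + l j y) ∈ lowDegree b s.card := by
  induction s using Finset.induction_on with
  | empty => simpa using one_mem_lowDegree b 0
  | insert j s hj ih =>
    rw [Finset.prod_insert hj, Finset.card_insert_of_notMem hj]
    exact affine_mul_mem_lowDegree b (l j) (c j) ih

/-- The indicator function of a coset of `U` is a polynomial of degree at most the codimension
of `U`. -/
theorem indicator_coset_mem_lowDegree [Finite ι] (U : Submodule (ZMod 2) E) (x : E) :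
    (fun y => if y - x ∈ U then (1 : ZMod 2) else 0) ∈
      lowDegree b (Module.finrank (ZMod 2) (E ⧸ U)) := by
  have : Module.Finite (ZMod 2) E := Module.Finite.of_basis b
  let e := Module.finBasis (ZMod 2) (E ⧸ U)
  have h := prod_affine_mem_lowDegree b Finset.univ (fun j => e.coord j ∘ₗ U.mkQ)
    (fun j => 1 - e.coord j (U.mkQ x))
  rw [Finset.card_univ, Fintype.card_fin] at h
  convert h using 1
  ext y
  have hmem : y - x ∈ U ↔ ∀ j, e.coord j (U.mkQ (y - x)) = 0 := by
    rw [e.forall_coord_eq_zero_iff, Submodule.mkQ_apply, Submodule.Quotient.mk_eq_zero]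
  have hterm : ∀ j, 1 - e.coord j (U.mkQ x) + e.coord j (U.mkQ y) =
      1 + e.coord j (U.mkQ (y - x)) := fun j => by
    rw [map_sub, map_sub]; ring
  simp only [Finset.prod_apply, LinearMap.comp_apply, hterm]
  split_ifs with hy
  · rw [hmem] at hy
    simp only [hy, add_zero, Finset.prod_const_one]
  · rw [hmem] at hy
    push Not at hy
    obtain ⟨j, hj⟩ := hy
    have hone : ∀ a : ZMod 2, a ≠ 0 → 1 + a = 0 := by decide
    exact (Finset.prod_eq_zero (Finset.mem_univ j) (hone _ hj)).symm

end LowDegree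

theorem linearIndependent_of_triangular_eval {K X ι : Type*} [Field K] [LinearOrder ι] [Finite ι]
    (f : ι → X → K) (x : ι → X) (hdiag : ∀ i, f i (x i) ≠ 0)
    (hlt : ∀ i j, j < i → f i (x j) = 0) : LinearIndependent K f := by
  have := Fintype.ofFinite ι
  rw [Fintype.linearIndependent_iff]
  intro g hg i
  induction i using WellFoundedLT.induction with
  | ind j ih =>
    have h := congrFun hg (x j)
    rw [Finset.sum_apply, Finset.sum_eq_single j] at h
    · simpa [hdiag j] using h
    · intro i _ hij
      rcases lt_or_gt_of_ne hij with h | h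
      · simp [ih i h]
      · simp [hlt i j h]
    · simp

theorem sum_two_pow_sub_eq {α : Type*} (s : Finset α) (c : α → ℕ) (k : ℕ)
    (hc : ∀ a ∈ s, c a ≤ k) :
    ∑ a ∈ s, 2 ^ (k - c a) =
      s.card + ∑ t ∈ Finset.range k, 2 ^ (k - 1 - t) * (s.filter (c · ≤ t)).card := by
  have key : ∀ a ∈ s, 2 ^ (k - c a) =
      1 + ∑ t ∈ Finset.range k, if c a ≤ t then 2 ^ (k - 1 - t) else 0 := by
    intro a ha
    rw [← Finset.sum_range_reflect]
    have : ∀ t ∈ Finset.range k, (if c a ≤ k - 1 - t then 2 ^ (k - 1 - (k - 1 - t)) else 0) =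
        if t < k - c a then 2 ^ t else 0 := by
      intro t ht
      rw [Finset.mem_range] at ht
      have := hc a ha
      rw [show k - 1 - (k - 1 - t) = t by omega]
      exact if_congr (by omega) rfl rfl
    rw [Finset.sum_congr rfl this, ← Finset.sum_filter,
      show (Finset.range k).filter (· < k - c a) = Finset.range (k - c a) by
        ext t; simp; omega, Nat.geomSum_eq le_rfl]
    have := Nat.one_le_two_pow (n := k - c a)
    omega
  rw [Finset.sum_congr rfl key, Finset.sum_add_distrib, Finset.sum_comm]
  simp [Finset.sum_ite, mul_comm]

theorem sum_two_pow_sub_le {α β : Type*} (s : Finset α) (s' : Finset β) (c : α → ℕ) (c' : β → ℕ)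
    (k : ℕ) (hc : ∀ a ∈ s, c a ≤ k) (hc' : ∀ a ∈ s', c' a ≤ k)
    (h : ∀ t, (s.filter (c · ≤ t)).card ≤ (s'.filter (c' · ≤ t)).card) :
    ∑ a ∈ s, 2 ^ (k - c a) ≤ ∑ a ∈ s', 2 ^ (k - c' a) := by
  rw [sum_two_pow_sub_eq s c k hc, sum_two_pow_sub_eq s' c' k hc']
  have hcard := h k
  rw [Finset.filter_true_of_mem hc, Finset.filter_true_of_mem hc'] at hcard
  gcongr with t _
  exact h t

/-- If no coset `x i + U i` contains an earlier point `x j`, then `∑ |U i| ≤ 3 ^ dim E`. -/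
theorem sum_two_pow_finrank_le_three_pow {E ι : Type*} [AddCommGroup E] [Module (ZMod 2) E]
    [Module.Finite (ZMod 2) E] [LinearOrder ι] (s : Finset ι) (x : ι → E)
    (U : ι → Submodule (ZMod 2) E)
    (h : ∀ i ∈ s, ∀ j ∈ s, j < i → x j - x i ∉ U i) :
    ∑ i ∈ s, 2 ^ Module.finrank (ZMod 2) (U i) ≤ 3 ^ Module.finrank (ZMod 2) E := by
  set k := Module.finrank (ZMod 2) E
  let b := Module.finBasis (ZMod 2) E
  have hU : ∀ i, Module.finrank (ZMod 2) (E ⧸ U i) + Module.finrank (ZMod 2) (U i) = k :=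
    fun i => (U i).finrank_quotient_add_finrank
  have hsum : ∑ S : Finset (Fin k), 2 ^ (k - S.card) = 3 ^ k := by
    simpa only [one_pow, one_mul, Fintype.card_fin, Nat.reduceAdd] using
      Fintype.sum_pow_mul_eq_add_pow (Fin k) (1 : ℕ) 2
  calc ∑ i ∈ s, 2 ^ Module.finrank (ZMod 2) (U i)
      = ∑ i ∈ s, 2 ^ (k - Module.finrank (ZMod 2) (E ⧸ U i)) :=
        Finset.sum_congr rfl fun i _ => by rw [← hU i, Nat.add_sub_cancel_left]
    _ ≤ ∑ S : Finset (Fin k), 2 ^ (k - S.card) := by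
        refine sum_two_pow_sub_le _ _ _ _ k (fun i _ => by have := hU i; omega)
          (fun S _ => by simpa using S.card_le_univ) fun t => ?_
        set s' := s.filter fun i => Module.finrank (ZMod 2) (E ⧸ U i) ≤ t
        have hli := linearIndependent_of_triangular_eval (K := ZMod 2) (ι := s')
          (fun i y => if y - x i ∈ U i then 1 else 0) (fun i => x i) (by simp)
          (fun i j hji => if_neg
            (h i (Finset.mem_filter.1 i.2).1 j (Finset.mem_filter.1 j.2).1 hji))
        let m : Finset (E → ZMod 2) :=
          (Finset.univ.filter fun S : Finset (Fin k) => S.card ≤ t).image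
            fun S y => ∏ i ∈ S, b.coord i y
        have hspan : Submodule.span (ZMod 2) (m : Set (E → ZMod 2)) = lowDegree b t := by
          simp [m, lowDegree]
        have hle := linearIndependent_le_span' _ hli (m : Set (E → ZMod 2)) (by
          rintro _ ⟨i, rfl⟩
          rw [SetLike.mem_coe, hspan]
          exact lowDegree_mono b (Finset.mem_filter.1 i.2).2
            (indicator_coset_mem_lowDegree b (U i) (x i)))
        have hle' : s'.card ≤ m.card := by simpa using hle
        exact hle'.trans Finset.card_image_le
    _ = 3 ^ k := hsum

/-- The contribution to the middle sum of the points `v i` lying in one coset of `H`. -/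
theorem sum_card_inter_le_of_coset {F ι : Type*} [AddCommGroup F] [Module (ZMod 2) F] [Finite F]
    [DecidableEq F] [LinearOrder ι] [Fintype ι] (v : ι → F) (N : ι → Finset F)
    (hN : ∀ i, N i ⊆ Finset.univ.image v)
    (hadd : ∀ i, ∀ w ∈ N i, v i + w ∈ N i)
    (hspan : ∀ i j, j < i → v j ∉ Submodule.span (ZMod 2) ((N i + N i : Finset F) : Set F))
    (H : Submodule (ZMod 2) F) (q : F ⧸ H) :
    (∑ i with H.mkQ (v i) = q, ((N i).filter (· ∈ H)).card) ^ 2 ≤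
      (Finset.univ.filter fun i => H.mkQ (v i) = q).card ^ 2 *
        3 ^ Module.finrank (ZMod 2) H := by
  set T := Finset.univ.filter fun i => H.mkQ (v i) = q
  have hchar : ∀ a : F, a + a = 0 := fun a => by
    rw [← two_smul (ZMod 2) a, show (2 : ZMod 2) = 0 from rfl, zero_smul]
  have hcard : ∀ i ∈ T, ((N i).filter (· ∈ H)).card ≤ T.card := by
    intro i hi
    refine le_trans ?_ (Finset.card_image_le (s := T) (f := fun j => v i + v j))
    refine Finset.card_le_card fun w hw => ?_
    obtain ⟨hw, hwH⟩ := Finset.mem_filter.1 hw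
    obtain ⟨j, -, hj⟩ := Finset.mem_image.1 (hN i (hadd i w hw))
    refine Finset.mem_image.2 ⟨j, Finset.mem_filter.2 ⟨Finset.mem_univ j, ?_⟩, ?_⟩
    · rw [hj, map_add, (Finset.mem_filter.1 hi).2, Submodule.mkQ_apply,
        (Submodule.Quotient.mk_eq_zero H).2 hwH, add_zero]
    · rw [hj, ← add_assoc, hchar, zero_add]
  have hsq : ∑ i ∈ T, ((N i).filter (· ∈ H)).card ≤ T.card * T.card := by
    simpa using Finset.sum_le_card_nsmul T _ _ hcard
  have hthree : ∑ i ∈ T, ((N i).filter (· ∈ H)).card ≤ 3 ^ Module.finrank (ZMod 2) H := by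
    obtain ⟨π, hπ⟩ := H.subtype.exists_leftInverse_of_injective (by simp)
    have hπ' : ∀ y (hy : y ∈ H), π y = ⟨y, hy⟩ := fun y hy => LinearMap.congr_fun hπ ⟨y, hy⟩
    let W i := Submodule.span (ZMod 2) ((N i + N i : Finset F) : Set F)
    have hmem : ∀ i, ∀ a ∈ N i, ∀ c ∈ N i, a + c ∈ W i := fun i a ha c hc =>
      Submodule.subset_span (Finset.mem_coe.2 (Finset.add_mem_add ha hc))
    let T' := T.filter fun i => ((N i).filter (· ∈ H)).Nonempty
    calc ∑ i ∈ T, ((N i).filter (· ∈ H)).card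
        = ∑ i ∈ T', ((N i).filter (· ∈ H)).card := by
          refine (Finset.sum_filter_of_ne fun i _ hi => ?_).symm
          exact Finset.card_ne_zero.1 hi
      _ ≤ ∑ i ∈ T', 2 ^ Module.finrank (ZMod 2) ((W i).comap H.subtype) := by
          refine Finset.sum_le_sum fun i hi => ?_
          obtain ⟨a, ha⟩ := (Finset.mem_filter.1 hi).2
          obtain ⟨ha, haH⟩ := Finset.mem_filter.1 ha
          have h2 : Nat.card ((W i).comap H.subtype) =
              2 ^ Module.finrank (ZMod 2) ((W i).comap H.subtype) := by
            simpa using Module.natCard_eq_pow_finrank (K := ZMod 2)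
              (V := (W i).comap H.subtype)
          rw [← h2, ← Nat.card_eq_finsetCard]
          refine Nat.card_le_card_of_injective
            (fun w => ⟨⟨w + a, H.add_mem (Finset.mem_filter.1 w.2).2 haH⟩,
              hmem i _ (Finset.mem_filter.1 w.2).1 a ha⟩) fun w w' hww => ?_
          have h : (w : F) + a = w' + a :=
            congrArg (fun z : (W i).comap H.subtype => ((z : H) : F)) hww
          exact Subtype.ext (add_right_cancel h)
      _ ≤ 3 ^ Module.finrank (ZMod 2) H := by
          refine sum_two_pow_finrank_le_three_pow T' (fun i => π (v i)) _ ?_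
          intro i hi j hj hji hmemU
          obtain ⟨hiT, a, ha⟩ := Finset.mem_filter.1 hi
          have ha := (Finset.mem_filter.1 ha).1
          have hij : v j - v i ∈ H := by
            rw [← Submodule.Quotient.mk_eq_zero, ← Submodule.mkQ_apply, map_sub,
              (Finset.mem_filter.1 hiT).2,
              (Finset.mem_filter.1 (Finset.mem_filter.1 hj).1).2, sub_self]
          have hvi : v i ∈ W i := by
            have := hmem i _ (hadd i a ha) a ha
            rwa [add_assoc, hchar, add_zero] at this
          rw [← map_sub, hπ' _ hij] at hmemU
          have := (W i).add_mem hmemU hvi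
          exact hspan i j hji (by rwa [Submodule.subtype_apply, sub_add_cancel] at this)
  rw [sq, sq]
  exact Nat.mul_le_mul hsq hthree

theorem sum_card_inter_le {F ι : Type*} [AddCommGroup F] [Module (ZMod 2) F] [Finite F]
    [DecidableEq F] [LinearOrder ι] [Fintype ι] (v : ι → F) (N : ι → Finset F)
    (hN : ∀ i, N i ⊆ Finset.univ.image v)
    (hadd : ∀ i, ∀ w ∈ N i, v i + w ∈ N i)
    (hspan : ∀ i j, j < i → v j ∉ Submodule.span (ZMod 2) ((N i + N i : Finset F) : Set F))
    (H : Submodule (ZMod 2) F) {X : ℝ} (hX : 0 ≤ X)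
    (hXsq : 3 ^ Module.finrank (ZMod 2) H ≤ X ^ 2) :
    ∑ i, (((N i).filter (· ∈ H)).card : ℝ) ≤ Fintype.card ι * X := by
  have hfiber : ∀ q : F ⧸ H,
      (∑ i with H.mkQ (v i) = q, (((N i).filter (· ∈ H)).card : ℝ)) ≤
        (Finset.univ.filter fun i => H.mkQ (v i) = q).card * X := by
    intro q
    have h : (∑ i with H.mkQ (v i) = q, (((N i).filter (· ∈ H)).card : ℝ)) ^ 2 ≤
        ((Finset.univ.filter fun i => H.mkQ (v i) = q).card : ℝ) ^ 2 *
          3 ^ Module.finrank (ZMod 2) H := by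
      exact_mod_cast sum_card_inter_le_of_coset v N hN hadd hspan H q
    refine (pow_le_pow_iff_left₀ (Finset.sum_nonneg fun _ _ => Nat.cast_nonneg _)
      (mul_nonneg (Nat.cast_nonneg _) hX) two_ne_zero).1 (h.trans ?_)
    rw [mul_pow]
    exact mul_le_mul_of_nonneg_left hXsq (sq_nonneg _)
  have : Finite (F ⧸ H) := Finite.of_surjective H.mkQ H.mkQ_surjective
  have := Fintype.ofFinite (F ⧸ H)
  have hcard : ∑ q, (Finset.univ.filter fun i => H.mkQ (v i) = q).card = Fintype.card ι :=
    (Finset.card_eq_sum_card_fiberwise fun _ _ => Finset.mem_coe.2 (Finset.mem_univ _)).symm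
  calc ∑ i, (((N i).filter (· ∈ H)).card : ℝ)
      = ∑ q, ∑ i with H.mkQ (v i) = q, (((N i).filter (· ∈ H)).card : ℝ) :=
        (Finset.sum_fiberwise _ _ _).symm
    _ ≤ ∑ q, (Finset.univ.filter fun i => H.mkQ (v i) = q).card * X :=
        Finset.sum_le_sum fun q _ => hfiber q
    _ = Fintype.card ι * X := by
        rw [← Finset.sum_mul, ← Nat.cast_sum, hcard]

/-- Lemma (a) on middle sums. There is `C > 0` such that for all systems
`(v, N)` satisfying conditions (i), (ii) and for every subspace `H ≤ 𝔽₂^d`,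
`∑_{i : v i ∉ H} |N i ∩ (H ∪ (v i + H))| ≤ C * n * |H| ^ ((log₂ 3)/2)`.
(In characteristic 2, `w ∈ v i + H ↔ w + v i ∈ H`.) -/
theorem statement10 :
    ∃ C : ℝ, 0 < C ∧
      ∀ (n d : ℕ) (v : Fin n → (Fin d → ZMod 2)),
        Function.Injective v →
        ∀ N : Fin n → Finset (Fin d → ZMod 2),
          (∀ i, N i ⊆ Finset.univ.image v) →
          (∀ i, (N i).image (fun w => v i + w) = N i) →
          (∀ i j : Fin n, j < i →
            v j ∉ Submodule.span (ZMod 2)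
              (((N i + N i : Finset (Fin d → ZMod 2))) : Set (Fin d → ZMod 2))) →
          ∀ H : Submodule (ZMod 2) (Fin d → ZMod 2),
            (∑ i ∈ Finset.univ.filter (fun i : Fin n => v i ∉ H),
              (((N i).filter (fun w => w ∈ H ∨ w + v i ∈ H)).card : ℝ))
              ≤ C * n * (Nat.card H : ℝ) ^ (Real.logb 2 3 / 2) := by
  refine ⟨2, two_pos, fun n d v _ N hN himage hspan H => ?_⟩
  have hadd : ∀ i, ∀ w ∈ N i, v i + w ∈ N i := fun i w hw => by
    have := Finset.mem_image_of_mem (fun w => v i + w) hw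
    rwa [himage i] at this
  set X : ℝ := (Nat.card H : ℝ) ^ (Real.logb 2 3 / 2)
  have hX : 0 ≤ X := by positivity
  have hXsq : X ^ 2 = 3 ^ Module.finrank (ZMod 2) H := by
    have hcard : (Nat.card H : ℝ) = 2 ^ Module.finrank (ZMod 2) H := by
      rw [Module.natCard_eq_pow_finrank (K := ZMod 2)]
      simp
    rw [← Real.rpow_natCast X, ← Real.rpow_mul (by positivity), hcard, ← Real.rpow_natCast 2,
      ← Real.rpow_mul two_pos.le]
    norm_num
    rw [mul_comm, Real.rpow_mul two_pos.le, Real.rpow_logb two_pos (by norm_num) (by norm_num),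
      Real.rpow_natCast]
  have hdouble : ∀ i, ((N i).filter (fun w => w ∈ H ∨ w + v i ∈ H)).card ≤
      2 * ((N i).filter (· ∈ H)).card := by
    intro i
    rw [Finset.filter_or, two_mul]
    refine (Finset.card_union_le _ _).trans (Nat.add_le_add_left ?_ _)
    refine Finset.card_le_card_of_injOn (v i + ·) (fun w hw => ?_) (add_right_injective _).injOn
    obtain ⟨hw, hwH⟩ := Finset.mem_filter.1 hw
    exact Finset.mem_filter.2 ⟨hadd i w hw, by rwa [add_comm] at hwH⟩
  calc _ ≤ ∑ i, (((N i).filter (fun w => w ∈ H ∨ w + v i ∈ H)).card : ℝ) :=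
        Finset.sum_le_sum_of_subset_of_nonneg (Finset.filter_subset _ _) fun _ _ _ => by positivity
    _ ≤ ∑ i, 2 * (((N i).filter (· ∈ H)).card : ℝ) :=
        Finset.sum_le_sum fun i _ => by exact_mod_cast hdouble i
    _ = 2 * ∑ i, (((N i).filter (· ∈ H)).card : ℝ) := by rw [Finset.mul_sum]
    _ ≤ 2 * (n * X) :=
        mul_le_mul_of_nonneg_left
          (by simpa using sum_card_inter_le v N hN hadd hspan H hX hXsq.ge) two_pos.le
    _ = 2 * n * X := (mul_assoc _ _ _).symm
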